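/- For every positive integer n, the circulant graph C_{3n+6}({1, n+1, n+3}) is edge-transitive. -/

import Mathlib

/-- A graph is edge-transitive if its automorphism group acts transitively on its edge set. -/
def EdgeTransitive {V : Type*} (G : SimpleGraph V) : Prop :=
  ∀ e₁ ∈ G.edgeSet, ∀ e₂ ∈ G.edgeSet, ∃ φ : G ≃g G, Sym2.map φ e₁ = e₂

/-- The circulant graph `C_n(L)` on vertex set `ZMod n`: distinct vertices `x`, `y` are
adjacent iff `x - y ≡ ±l (mod n)` for some `l ∈ L`. -/
def circulant (n : ℕ) (L : Finset ℤ) : SimpleGraph (ZMod n) :=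
  SimpleGraph.circulantGraph {x : ZMod n | ∃ l ∈ L, x = (l : ZMod n)}

lemma dvd_add_two_three_mul_add_six (n : ℕ) : n + 2 ∣ 3 * n + 6 := ⟨3, by ring⟩

/-- Reduction modulo `n + 2`; its fibres are the classes of vertices with equal neighbourhoods. -/
def fiberMap (n : ℕ) : ZMod (3 * n + 6) →+* ZMod (n + 2) :=
  ZMod.castHom (dvd_add_two_three_mul_add_six n) (ZMod (n + 2))

/-- An element that reduces to `1` modulo `n + 2` is one of `1`, `n + 3`, `-(n + 1)`. -/
lemma eq_of_fiberMap_eq_one {n : ℕ} {d : ZMod (3 * n + 6)} (h : fiberMap n d = 1) :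
    d = 1 ∨ d = (n : ZMod (3 * n + 6)) + 3 ∨ -d = (n : ZMod (3 * n + 6)) + 1 := by
  obtain ⟨z, rfl⟩ := ZMod.intCast_surjective d
  have h1 : ((1 : ℤ) : ZMod (n + 2)) = (z : ZMod (n + 2)) := by
    rw [map_intCast] at h
    rw [h, Int.cast_one]
  obtain ⟨q, hq⟩ := (ZMod.intCast_eq_intCast_iff_dvd_sub _ _ _).1 h1
  have hN : (3 * n + 6 : ZMod (3 * n + 6)) = 0 := by
    exact_mod_cast ZMod.natCast_self (3 * n + 6)
  have hz : (z : ZMod (3 * n + 6)) = 1 + (n + 2) * (q : ZMod (3 * n + 6)) := by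
    have : z = 1 + (n + 2) * q := by push_cast at hq; linarith
    rw [this]; push_cast; ring
  have hq3 : q = 3 * (q / 3) + q % 3 := by omega
  rw [hq3] at hz
  rw [hz]
  have hr : q % 3 = 0 ∨ q % 3 = 1 ∨ q % 3 = 2 := by omega
  rcases hr with hr | hr | hr <;> rw [hr] <;> push_cast
  · left
    linear_combination ((q / 3 : ℤ) : ZMod (3 * n + 6)) * hN
  · right; left
    linear_combination ((q / 3 : ℤ) : ZMod (3 * n + 6)) * hN
  · right; right
    linear_combination (-((q / 3 : ℤ) : ZMod (3 * n + 6)) - 1) * hN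

lemma circulant_adj_iff (n : ℕ) (x y : ZMod (3 * n + 6)) :
    (circulant (3*n+6) ({1, (n:ℤ)+1, (n:ℤ)+3} : Finset ℤ)).Adj x y ↔
      fiberMap n x - fiberMap n y = 1 ∨ fiberMap n x - fiberMap n y = -1 := by
  have hk : (n + 2 : ZMod (n + 2)) = 0 := by exact_mod_cast ZMod.natCast_self (n + 2)
  have : Fact (1 < n + 2) := ⟨by omega⟩
  simp only [circulant, SimpleGraph.circulantGraph_adj, Set.mem_ofPred_eq, Finset.mem_insert,
    Finset.mem_singleton, exists_eq_or_imp, exists_eq_left, Int.cast_one, Int.cast_add,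
    Int.cast_natCast, Int.cast_ofNat, ← map_sub]
  have image {d : ZMod (3 * n + 6)} (h : d = 1 ∨ d = n + 1 ∨ d = n + 3) :
      fiberMap n d = 1 ∨ fiberMap n d = -1 := by
    rcases h with rfl | rfl | rfl
    · simp
    · right; simp only [map_add, map_natCast, map_one]; linear_combination hk
    · left; simp only [map_add, map_natCast, map_ofNat]; linear_combination hk
  constructor
  · rintro ⟨-, h | h⟩
    · exact image h
    · have := image h
      rw [← neg_sub, map_neg] at this
      rcases this with h | h
      · right; rw [← h, neg_neg]
      · left; exact neg_injective h
  · intro h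
    refine ⟨?_, ?_⟩
    · rintro rfl
      simp at h
    · rcases h with h | h
      · have := eq_of_fiberMap_eq_one h
        rw [neg_sub] at this
        tauto
      · have := eq_of_fiberMap_eq_one (n := n) (d := y - x) (by rw [← neg_sub, map_neg, h, neg_neg])
        rw [neg_sub] at this
        tauto

/-- The affine permutation `x ↦ ε * x + c` of a commutative ring. -/
def affinePerm {R : Type*} [CommRing R] (ε : Rˣ) (c : R) : Equiv.Perm R :=
  ε.mulLeft.trans (Equiv.addRight c)

lemma affinePerm_apply {R : Type*} [CommRing R] (ε : Rˣ) (c x : R) :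
    affinePerm ε c x = ε * x + c := rfl

lemma apply_swap_of_apply_eq {α β : Type*} [DecidableEq α] (f : α → β) {u v : α}
    (h : f u = f v) (x : α) : f (Equiv.swap u v x) = f x := by
  rw [Equiv.swap_apply_def]
  split_ifs with h1 h2
  · rw [h1, h]
  · rw [h2, h]
  · rfl

/-- This circulant graph is edge-transitive for every positive integer `n`. -/
theorem circulant_class_edgeTransitive (n : ℕ) (hn : 0 < n) :
    EdgeTransitive (circulant (3*n+6) ({1, (n:ℤ)+1, (n:ℤ)+3} : Finset ℤ)) := by
  intro e₁ he₁ e₂ he₂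
  induction e₁ using Sym2.ind with | _ a b => ?_
  induction e₂ using Sym2.ind with | _ a' b' => ?_
  rw [SimpleGraph.mem_edgeSet] at he₁ he₂
  have hab := he₁.ne
  have hab' := he₂.ne
  rw [circulant_adj_iff] at he₁ he₂
  obtain ⟨ε, hε, hεab⟩ : ∃ ε : (ZMod (3 * n + 6))ˣ, (ε = 1 ∨ ε = -1) ∧
      fiberMap n ε * (fiberMap n a - fiberMap n b) = fiberMap n a' - fiberMap n b' := by
    rcases he₁ with h | h <;> rcases he₂ with h' | h' <;> rw [h, h']
    · exact ⟨1, by simp⟩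
    · exact ⟨-1, by simp⟩
    · exact ⟨-1, by simp⟩
    · exact ⟨1, by simp⟩
  set ψ := affinePerm ε (a' - ε * a) with hψ
  have hψa : ψ a = a' := by rw [hψ, affinePerm_apply]; ring
  have hψb : fiberMap n (ψ b) = fiberMap n b' := by
    simp only [hψ, affinePerm_apply, map_add, map_sub, map_mul]
    linear_combination -hεab
  have hfiber (x : ZMod (3 * n + 6)) : fiberMap n (ψ.trans (Equiv.swap (ψ b) b') x) =
      fiberMap n ε * fiberMap n x + fiberMap n (a' - ε * a) := by
    rw [Equiv.trans_apply, apply_swap_of_apply_eq _ hψb, hψ, affinePerm_apply, map_add, map_mul]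
  refine ⟨⟨ψ.trans (Equiv.swap (ψ b) b'), ?_⟩, ?_⟩
  · intro x y
    rw [circulant_adj_iff, circulant_adj_iff, hfiber, hfiber, add_sub_add_right_eq_sub, ← mul_sub]
    rcases hε with rfl | rfl
    · simp
    · simp only [Units.val_neg, Units.val_one, map_neg, map_one, neg_one_mul, neg_inj]
      rw [neg_eq_iff_eq_neg, or_comm]
  · have ha : Equiv.swap (ψ b) b' (ψ a) = a' := by
      rw [Equiv.swap_apply_of_ne_of_ne (ψ.injective.ne hab) (hψa ▸ hab'), hψa]
    have hb : Equiv.swap (ψ b) b' (ψ b) = b' := Equiv.swap_apply_left _ _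
    rw [Sym2.map_mk]
    exact congrArg₂ (fun u v => s(u, v)) ha hb
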